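/- A Boolean function in character form f : 𝔽₂ⁿ → {−1, 1} satisfies the strict avalanche criterion if and only if ∑_{w ∈ 𝔽₂ⁿ} (−1)^{w·c} f̂(w)² = 0 for every c ∈ 𝔽₂ⁿ of Hamming weight 1. -/

import Mathlib

open Finset

/-- The Fourier coefficient of `f : 𝔽₂ⁿ → ℝ` at `u ∈ 𝔽₂ⁿ`:
`f̂(u) = 2^{−n} ∑_{x ∈ 𝔽₂ⁿ} f(x)(−1)^{u·x}`, where `u·x` is the inner product over `𝔽₂`. -/
noncomputable def walshCoeff {n : ℕ} (f : (Fin n → ZMod 2) → ℝ) (u : Fin n → ZMod 2) : ℝ :=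
  ((2 : ℝ) ^ n)⁻¹ * ∑ x : Fin n → ZMod 2, f x * (-1 : ℝ) ^ (∑ i, u i * x i).val

/-- The Hamming weight of `a ∈ 𝔽₂ⁿ`: the number of nonzero coordinates. -/
def hammingWt {n : ℕ} (a : Fin n → ZMod 2) : ℕ :=
  (univ.filter fun i => a i = 1).card

/-- `f : 𝔽₂ⁿ → {−1, 1}` satisfies the strict avalanche criterion (SAC) if for every
`a ∈ 𝔽₂ⁿ` with Hamming weight `1`, the derivative `x ↦ f(x)f(x+a)` is balanced, i.e.,
takes each of the values `1` and `−1` on exactly `2^{n−1}` inputs. -/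
def satisfiesSAC {n : ℕ} (f : (Fin n → ZMod 2) → ℝ) : Prop :=
  ∀ a : Fin n → ZMod 2, hammingWt a = 1 →
    (univ.filter fun x => f x * f (x + a) = 1).card = 2 ^ (n - 1) ∧
    (univ.filter fun x => f x * f (x + a) = -1).card = 2 ^ (n - 1)

theorem neg_one_pow_val_add (a b : ZMod 2) :
    (-1 : ℝ) ^ (a + b).val = (-1) ^ a.val * (-1) ^ b.val := by
  rw [ZMod.val_add, ← pow_add, ← neg_one_pow_eq_pow_mod_two]

/-- Orthogonality of the characters of `𝔽₂ⁿ`. -/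
theorem sum_neg_one_pow_dotProduct {n : ℕ} (z : Fin n → ZMod 2) :
    ∑ w : Fin n → ZMod 2, (-1 : ℝ) ^ (∑ i, w i * z i).val = if z = 0 then 2 ^ n else 0 := by
  split_ifs with hz
  · simp [hz]
  · obtain ⟨j, hj⟩ := Function.ne_iff.mp hz
    have hj1 : z j = 1 := by
      generalize z j = t at hj
      rw [Pi.zero_apply] at hj
      decide +revert
    have hflip : ∀ w : Fin n → ZMod 2,
        (-1 : ℝ) ^ (∑ i, (w + Pi.single j 1 : Fin n → ZMod 2) i * z i).val =
          -(-1 : ℝ) ^ (∑ i, w i * z i).val := by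
      intro w
      have : ∑ i, (w + Pi.single j 1 : Fin n → ZMod 2) i * z i = ∑ i, w i * z i + 1 := by
        simp [add_mul, Finset.sum_add_distrib, Pi.single_apply, hj1]
      rw [this, neg_one_pow_val_add, ZMod.val_one]
      ring
    have := Equiv.sum_comp (Equiv.addRight (Pi.single j (1 : ZMod 2)))
      fun w : Fin n → ZMod 2 => (-1 : ℝ) ^ (∑ i, w i * z i).val
    simp only [Equiv.coe_addRight, hflip, Finset.sum_neg_distrib] at this
    linarith

/-- The Wiener–Khinchin identity: the inverse transform of the squared Fourier coefficients is the
normalized autocorrelation. -/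
theorem sum_neg_one_pow_mul_walshCoeff_sq {n : ℕ} (f : (Fin n → ZMod 2) → ℝ)
    (c : Fin n → ZMod 2) :
    ∑ w : Fin n → ZMod 2, (-1 : ℝ) ^ (∑ i, w i * c i).val * (walshCoeff f w) ^ 2 =
      ((2 : ℝ) ^ n)⁻¹ * ∑ x, f x * f (x + c) := by
  have hchar : ∀ w x y : Fin n → ZMod 2,
      (-1 : ℝ) ^ (∑ i, w i * c i).val *
        ((f x * (-1) ^ (∑ i, w i * x i).val) * (f y * (-1) ^ (∑ i, w i * y i).val)) =
      f x * f y * (-1) ^ (∑ i, w i * (x + c + y) i).val := by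
    intro w x y
    have : ∑ i, w i * (x + c + y) i = ∑ i, w i * x i + ∑ i, w i * c i + ∑ i, w i * y i := by
      simp [mul_add, Finset.sum_add_distrib]
    rw [this, neg_one_pow_val_add, neg_one_pow_val_add]
    ring
  have hzero : ∀ x y : Fin n → ZMod 2, x + c + y = 0 ↔ x + c = y := by
    intro x y
    rw [add_eq_zero_iff_eq_neg]
    have : -y = y := funext fun i => ZMod.neg_eq_self_mod_two (y i)
    rw [this]
  calc ∑ w : Fin n → ZMod 2, (-1 : ℝ) ^ (∑ i, w i * c i).val * (walshCoeff f w) ^ 2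
      = (((2 : ℝ) ^ n)⁻¹) ^ 2 * ∑ w : Fin n → ZMod 2, ∑ x, ∑ y,
          f x * f y * (-1) ^ (∑ i, w i * (x + c + y) i).val := by
        rw [Finset.mul_sum]
        refine Finset.sum_congr rfl fun w _ => ?_
        simp only [← hchar, ← Finset.mul_sum, ← Finset.sum_mul, walshCoeff]
        ring
    _ = (((2 : ℝ) ^ n)⁻¹) ^ 2 * ∑ x, ∑ y, f x * f y * (if x + c = y then 2 ^ n else 0) := by
        rw [Finset.sum_comm]
        congr 1
        refine Finset.sum_congr rfl fun x _ => ?_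
        rw [Finset.sum_comm]
        refine Finset.sum_congr rfl fun y _ => ?_
        rw [← Finset.mul_sum, sum_neg_one_pow_dotProduct]
        simp only [hzero]
    _ = ((2 : ℝ) ^ n)⁻¹ * ∑ x, f x * f (x + c) := by
        simp only [mul_ite, mul_zero, Finset.sum_ite_eq, Finset.mem_univ, if_true,
          ← Finset.sum_mul]
        field_simp

/-- A `±1`-valued function takes each value equally often exactly when it sums to zero. -/
theorem card_eq_half_iff_sum_eq_zero {α : Type*} [Fintype α] (g : α → ℝ)
    (hg : ∀ x, g x = 1 ∨ g x = -1) (m : ℕ) (hm : Fintype.card α = 2 * m) :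
    ((univ.filter fun x => g x = 1).card = m ∧ (univ.filter fun x => g x = -1).card = m) ↔
      ∑ x, g x = 0 := by
  have hneg : (univ.filter fun x => g x = -1) = univ.filter fun x => ¬ g x = 1 := by
    refine Finset.filter_congr fun x _ => ?_
    rcases hg x with h | h <;> rw [h] <;> norm_num
  have hcard : (univ.filter fun x => g x = 1).card + (univ.filter fun x => g x = -1).card =
      2 * m := by
    rw [hneg, Finset.card_filter_add_card_filter_not, Finset.card_univ, hm]
  have hsum : ∑ x, g x =
      ((univ.filter fun x => g x = 1).card : ℝ) - (univ.filter fun x => g x = -1).card := by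
    rw [Finset.card_filter, Finset.card_filter]
    push_cast
    rw [← Finset.sum_sub_distrib]
    refine Finset.sum_congr rfl fun x _ => ?_
    rcases hg x with h | h <;> rw [h] <;> norm_num
  rw [hsum, sub_eq_zero, Nat.cast_inj]
  omega

/-- A Boolean function in character form `f : 𝔽₂ⁿ → {−1, 1}` satisfies the strict avalanche
criterion if and only if `∑_{w ∈ 𝔽₂ⁿ} (−1)^{w·c} f̂(w)² = 0` for every `c ∈ 𝔽₂ⁿ` of
Hamming weight `1`. -/
theorem sac_iff_fourier_sum_zero {n : ℕ} (f : (Fin n → ZMod 2) → ℝ)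
    (hf : ∀ x, f x = 1 ∨ f x = -1) :
    satisfiesSAC f ↔
      ∀ c : Fin n → ZMod 2, hammingWt c = 1 →
        ∑ w : Fin n → ZMod 2,
          (-1 : ℝ) ^ (∑ i, w i * c i).val * (walshCoeff f w) ^ 2 = 0 := by
  refine forall₂_congr fun c hc => ?_
  have hn : n ≠ 0 := by
    rintro rfl
    simp [hammingWt] at hc
  have hcard : Fintype.card (Fin n → ZMod 2) = 2 * 2 ^ (n - 1) := by
    rw [mul_pow_sub_one hn]
    simp
  have hprod : ∀ x, f x * f (x + c) = 1 ∨ f x * f (x + c) = -1 := by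
    intro x
    rcases hf x with h | h <;> rcases hf (x + c) with h' | h' <;> simp [h, h']
  rw [sum_neg_one_pow_mul_walshCoeff_sq, mul_eq_zero_iff_left (by positivity)]
  exact card_eq_half_iff_sum_eq_zero _ hprod _ hcard
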